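/- arXiv:1101.4973 — 2 statements merged into one kernel-verified Lean document; each statement's English description precedes it below -/
import Mathlib

section
/- Let D be a balanced bipartite digraph with colour classes X and Y of cardinality a ≥ 2. Suppose d^+(u) + d^-(v) ≥ a + 2 whenever u and v lie in opposite colour classes and uv is not an arc of D. Then D contains a Hamiltonian cycle, i.e., an oriented cycle of length 2a passing through all vertices. -/
open Finset

/-- Out-degree of a vertex in the digraph with arc relation `A`. -/
def outDeg {V : Type*} [Fintype V] (A : V → V → Prop) [DecidableRel A] (v : V) : ℕ :=
  (Finset.univ.filter (fun w => A v w)).card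

/-- In-degree of a vertex. -/
def inDeg {V : Type*} [Fintype V] (A : V → V → Prop) [DecidableRel A] (v : V) : ℕ :=
  (Finset.univ.filter (fun w => A w v)).card

/-- Number of out-neighbours of `v` lying in the set `S`. -/
def outDegOn {V : Type*} (A : V → V → Prop) [DecidableRel A] (S : Finset V) (v : V) : ℕ :=
  (S.filter (fun w => A v w)).card

/-- Number of in-neighbours of `v` lying in the set `S`. -/
def inDegOn {V : Type*} (A : V → V → Prop) [DecidableRel A] (S : Finset V) (v : V) : ℕ :=
  (S.filter (fun w => A w v)).card

/-- `D = (V, A)` is bipartite with colour classes `X`, `Y`. -/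
def IsBipartite {V : Type*} (A : V → V → Prop) (X Y : Finset V) : Prop :=
  Disjoint X Y ∧ (∀ v : V, v ∈ X ∨ v ∈ Y) ∧
    ∀ u v : V, A u v → (u ∈ X ∧ v ∈ Y) ∨ (u ∈ Y ∧ v ∈ X)

/-- An oriented path on `s` vertices `p 0, p 1, …, p (s-1)`. -/
def IsPath {V : Type*} (A : V → V → Prop) (s : ℕ) (p : ℕ → V) : Prop :=
  Set.InjOn p (Set.Iio s) ∧ ∀ i : ℕ, i + 1 < s → A (p i) (p (i + 1))

/-- An oriented cycle on `s` distinct vertices `p 0, …, p (s-1)` (indices mod `s`). -/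
def IsCycle {V : Type*} (A : V → V → Prop) (s : ℕ) (p : ℕ → V) : Prop :=
  Set.InjOn p (Set.Iio s) ∧ ∀ i : ℕ, i < s → A (p i) (p ((i + 1) % s))

/-- `M` is a matching from `X` to `Y`: an independent set of arcs with origin in `X`
and terminus in `Y`. -/
def IsMatching {V : Type*} (A : V → V → Prop) (X Y : Finset V) (M : Finset (V × V)) : Prop :=
  (∀ e ∈ M, e.1 ∈ X ∧ e.2 ∈ Y ∧ A e.1 e.2) ∧
    ∀ e ∈ M, ∀ e' ∈ M, e ≠ e' → e.1 ≠ e'.1 ∧ e.2 ≠ e'.2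

/-- A complete matching from `X` to `Y`: a matching consisting of `|X|` arcs. -/
def IsCompleteMatching {V : Type*} (A : V → V → Prop) (X Y : Finset V)
    (M : Finset (V × V)) : Prop :=
  IsMatching A X Y M ∧ M.card = X.card

/-- The path `p 0, …, p (s-1)` is compatible with the matching `M`: its arcs lie
alternately in `M` and outside `M`. -/
def PathCompat {V : Type*} (M : Finset (V × V)) (s : ℕ) (p : ℕ → V) : Prop :=
  ∀ i : ℕ, i + 2 < s → ((p i, p (i + 1)) ∈ M ↔ (p (i + 1), p (i + 2)) ∉ M)

/-- The cycle `p 0, …, p (s-1)` is compatible with the matching `M`. -/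
def CycleCompat {V : Type*} (M : Finset (V × V)) (s : ℕ) (p : ℕ → V) : Prop :=
  ∀ i : ℕ, i < s →
    ((p i, p ((i + 1) % s)) ∈ M ↔ (p ((i + 1) % s), p ((i + 2) % s)) ∉ M)

/-- The path `p 0, …, p (s-1)` avoids the vertex set `S`. -/
def Avoids {V : Type*} (s : ℕ) (p : ℕ → V) (S : Finset V) : Prop :=
  ∀ i : ℕ, i < s → p i ∉ S

namespace HC
open List

noncomputable def ind (p : Prop) : ℕ := by classical exact if p then 1 else 0

lemma ind_true {p : Prop} (h : p) : ind p = 1 := by simp [ind, h]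
lemma ind_false {p : Prop} (h : ¬ p) : ind p = 0 := by simp [ind, h]
lemma ind_le (p : Prop) : ind p ≤ 1 := by unfold ind; split <;> simp

lemma ind_add_le {p q : Prop} (h : ¬ (p ∧ q)) : ind p + ind q ≤ 1 := by
  by_cases hp : p <;> by_cases hq : q <;> simp_all [ind]

variable {V : Type*}

lemma noins_aux (R : V → V → Prop) (v : V) (l : List V) : ∀ (a : V)
    (_ : IsChain (fun a b => ¬ (R a v ∧ R v b)) (a :: l)),
    ((a :: l).map (fun w => ind (R v w) + ind (R w v))).sum ≤ l.length + 1 + ind (R v a) := by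
  induction l with
  | nil => intro a _; have := ind_le (R a v); simp; omega
  | cons b l ih =>
    intro a h
    rw [isChain_cons_cons] at h
    have h1 := ih b h.2
    have h2 := ind_add_le h.1
    rw [List.map_cons, List.sum_cons, List.length_cons]
    omega

lemma noins (R : V → V → Prop) (v : V) (l : List V)
    (h : IsChain (fun a b => ¬ (R a v ∧ R v b)) l) :
    (l.map (fun w => ind (R v w) + ind (R w v))).sum ≤ l.length + 1 := by
  cases l with
  | nil => simp
  | cons a l =>
    have := noins_aux R v l a h
    have := ind_le (R v a)
    simp only [List.length_cons]; omega

lemma maxlen {α : Type*} (p : α → Prop) (f : α → ℕ) (N : ℕ) (hb : ∀ l, p l → f l ≤ N)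
    (he : ∃ l, p l) : ∃ l, p l ∧ ∀ l', p l' → f l' ≤ f l := by
  classical
  obtain ⟨l, hl⟩ := he
  have := Nat.findGreatest_spec (P := fun n => ∃ l, p l ∧ f l = n) (hb l hl) ⟨l, hl, rfl⟩
  obtain ⟨l0, h0, h1⟩ := this
  refine ⟨l0, h0, fun l' hl' => ?_⟩
  rw [h1]
  exact Nat.le_findGreatest (hb l' hl') ⟨l', hl', rfl⟩

lemma minlen {α : Type*} (p : α → Prop) (f : α → ℕ)
    (he : ∃ l, p l) : ∃ l, p l ∧ ∀ l', p l' → f l ≤ f l' := by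
  classical
  have h : ∃ n, ∃ l, p l ∧ f l = n := by obtain ⟨l, hl⟩ := he; exact ⟨_, l, hl, rfl⟩
  obtain ⟨l0, h0, h1⟩ := Nat.find_spec h
  refine ⟨l0, h0, fun l' hl' => ?_⟩
  rw [h1]
  exact Nat.find_min' h ⟨l', hl', rfl⟩

def Cyc (R : V → V → Prop) (l : List V) : Prop :=
  l.Nodup ∧ l ≠ [] ∧ IsChain R (l ++ l)

lemma cyc_rot {R : V → V → Prop} {A B : List V} (h : Cyc R (A ++ B)) : Cyc R (B ++ A) := by
  obtain ⟨h1, h2, h3⟩ := h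
  refine ⟨(List.perm_append_comm.nodup_iff).1 h1, by simp at h2 ⊢; tauto, ?_⟩
  rcases A with _ | ⟨a, A⟩
  · simpa using h3
  rcases B with _ | ⟨b, B⟩
  · simpa using h3
  simp only [isChain_append, List.head?_append, List.getLast?_append, List.head?_cons] at h3 ⊢
  simp at h3 ⊢
  tauto

def Byp (R : V → V → Prop) (S : V → Prop) (p q : V) : Prop :=
  ∃ w1 w2, ¬ S w1 ∧ R p w1 ∧ Relation.ReflTransGen (fun a b => R a b ∧ ¬ S b) w1 w2 ∧ R w2 q

lemma path_of_reach {R : V → V → Prop} {S : V → Prop} {a b : V} (ha : ¬ S a)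
    (h : Relation.ReflTransGen (fun a b => R a b ∧ ¬ S b) a b) :
    ∃ Q : List V, Q.Nodup ∧ (∀ x ∈ Q, ¬ S x) ∧ IsChain R Q ∧ Q.head? = some a ∧
      Q.getLast? = some b := by
  classical
  induction h using Relation.ReflTransGen.head_induction_on with
  | refl => exact ⟨[b], by simp, by simpa using ha, by simp, by simp, by simp⟩
  | head h1 h2 ih =>
    rename_i a c
    obtain ⟨Q, q1, q2, q3, q4, q5⟩ := ih h1.2
    by_cases hm : a ∈ Q
    · obtain ⟨s, t, rfl⟩ := List.append_of_mem hm
      refine ⟨a :: t, (List.nodup_append.1 q1).2.1, fun x hx => q2 x (by simp at hx ⊢; tauto),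
        q3.right_of_append, by simp, ?_⟩
      simpa [List.getLast?_append] using q5
    · refine ⟨a :: Q, by simp [hm, q1], ?_, ?_, by simp, ?_⟩
      · intro x hx
        rcases List.mem_cons.1 hx with rfl | hx
        · exact ha
        · exact q2 x hx
      · rw [isChain_cons]
        refine ⟨fun y hy => ?_, q3⟩
        rw [q4] at hy
        cases hy
        exact h1.1
      · simp [List.getLast?_cons, q5]

/-- Splicing a bypass. -/
lemma splice {R : V → V → Prop} {S : V → Prop} {L : List V} {p q : V} (hL : L.Nodup)
    (hLS : ∀ x ∈ L, S x) (hc : IsChain R L) (hp : L.getLast? = some p) (hq : L.head? = some q)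
    (hB : Byp R S p q) : ∃ l, Cyc R l ∧ L.length < l.length := by
  obtain ⟨w1, w2, hw1, h1, h2, h3⟩ := hB
  obtain ⟨Q, q1, q2, q3, q4, q5⟩ := path_of_reach hw1 h2
  have hQ : Q ≠ [] := by rintro rfl; simp at q4
  refine ⟨L ++ Q, ⟨?_, by simp [hQ], ?_⟩, ?_⟩
  · rw [List.nodup_append]
    refine ⟨hL, q1, ?_⟩
    rintro a ha b hb rfl
    exact q2 _ hb (hLS _ ha)
  · simp only [isChain_append, List.head?_append, List.getLast?_append, q4, q5, hp, hq]
    simp [*]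
  · have := List.length_pos_iff.2 hQ
    simp; omega

lemma exists_byp [Fintype V] {R : V → V → Prop} (C : List V) (hC : C ≠ []) (z : V) (hz : z ∉ C)
    (hR : ∀ u v, ¬ R u v → ∃ w, R u w ∧ R w v) :
    ∃ p ∈ C, ∃ q ∈ C, Byp R (fun x => x ∈ C) p q := by
  obtain ⟨c, hc⟩ := List.exists_mem_of_ne_nil C hC
  have h1 : ∃ p ∈ C, ∃ w1, w1 ∉ C ∧ R p w1 ∧
      Relation.ReflTransGen (fun a b => R a b ∧ ¬ (b ∈ C)) w1 z := by
    by_cases h : R c z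
    · exact ⟨c, hc, z, hz, h, .refl⟩
    · obtain ⟨w, h1, h2⟩ := hR _ _ h
      by_cases hw : w ∈ C
      · exact ⟨w, hw, z, hz, h2, .refl⟩
      · exact ⟨c, hc, w, hw, h1, .single ⟨h2, hz⟩⟩
  have h2 : ∃ q ∈ C, ∃ w2, R w2 q ∧
      Relation.ReflTransGen (fun a b => R a b ∧ ¬ (b ∈ C)) z w2 := by
    by_cases h : R z c
    · exact ⟨c, hc, z, h, .refl⟩
    · obtain ⟨w, h1, h2⟩ := hR _ _ h
      by_cases hw : w ∈ C
      · exact ⟨w, hw, z, h1, .refl⟩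
      · exact ⟨c, hc, w, h2, .single ⟨h1, hw⟩⟩
  obtain ⟨p, hp, w1, a1, a2, a3⟩ := h1
  obtain ⟨q, hq, w2, b1, b2⟩ := h2
  exact ⟨p, hp, q, hq, w1, w2, a1, a2, a3.trans b2, b1⟩

def T (R : V → V → Prop) (S : V → Prop) (P U : List V) : Prop :=
  Cyc R (P ++ U) ∧ (∀ x, x ∈ P ++ U ↔ S x) ∧
    ∃ p q, P.getLast? = some p ∧ P.head? = some q ∧ Byp R S p q

lemma exists_T {R : V → V → Prop} {C : List V} (hC : Cyc R C) {p q : V} (hp : p ∈ C) (hq : q ∈ C)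
    (hB : Byp R (fun x => x ∈ C) p q) : ∃ P U, T R (fun x => x ∈ C) P U := by
  obtain ⟨s, t, rfl⟩ := List.append_of_mem hq
  have h1 := cyc_rot hC
  have h2 : p ∈ (q :: t) ++ s := by simp at hp ⊢; tauto
  obtain ⟨s', t', h3⟩ := List.append_of_mem h2
  refine ⟨s' ++ [p], t', ?_, ?_, p, q, by simp, ?_, hB⟩
  · rw [h3] at h1; simpa using h1
  · intro x
    have : x ∈ (q :: t) ++ s ↔ x ∈ s' ++ p :: t' := by rw [h3]
    simp at this ⊢; tauto
  · cases s' <;> simp at h3 ⊢ <;> tauto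

/-- Key counting contradiction. -/
lemma key [Fintype V] {R : V → V → Prop} {S : V → Prop} {P U : List V} (hr : ∀ x, R x x)
    (hd : ∀ u v, ¬ R u v → Fintype.card V + 2 ≤ (∑ w, ind (R u w)) + ∑ w, ind (R w v))
    (hT : T R S P U) (hmin : ∀ P' U', T R S P' U' → U.length ≤ U'.length)
    (hmax : ∀ l, Cyc R l → l.length ≤ (P ++ U).length) : False := by
  classical
  obtain ⟨hcyc, hS, p, q, hp, hq, hB⟩ := hT
  have hnd := hcyc.1
  have hchain : IsChain R (P ++ U) := hcyc.2.2.left_of_append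
  -- no short bypasses
  have f1 : ∀ u ∈ U, ¬ Byp R S p u := by
    intro u hu hb
    obtain ⟨U1, U2, rfl⟩ := List.append_of_mem hu
    have := hmin ((u :: U2) ++ P) U1 ⟨?_, ?_, p, u, ?_, by simp, hb⟩
    · simp at this
    · have : Cyc R ((P ++ U1) ++ (u :: U2)) := by simpa using hcyc
      simpa using cyc_rot this
    · intro x; rw [← hS]; simp; tauto
    · rw [List.getLast?_append, hp]; rfl
  have f2 : ∀ u ∈ U, ¬ Byp R S u q := by
    intro u hu hb
    obtain ⟨U1, U2, rfl⟩ := List.append_of_mem hu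
    have := hmin (P ++ U1 ++ [u]) U2 ⟨by simpa using hcyc, by simpa using hS, u, q, by simp,
      by simp [List.head?_append, hq], hb⟩
    simp at this
    omega
  -- maximal insertion
  obtain ⟨L, ⟨l1, l2, l3, l4, l5, l6⟩, hLmax⟩ := maxlen
    (fun L : List V => L.Nodup ∧ IsChain R L ∧ L.getLast? = some p ∧ L.head? = some q ∧
      (∀ x ∈ P, x ∈ L) ∧ (∀ x ∈ L, S x)) List.length (Fintype.card V)
    (fun l hl => hl.1.length_le_card)
    ⟨P, hnd.of_append_left, hchain.left_of_append, hp, hq, fun x hx => hx,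
      fun x hx => (hS x).1 (by simp [hx])⟩
  by_cases hall : ∀ x, S x → x ∈ L
  · obtain ⟨l, hl, hlen⟩ := splice l1 l6 l2 l3 l4 hB
    have := hmax l hl
    have : (P ++ U).length ≤ L.length :=
      (hnd.subperm (fun x hx => hall x ((hS x).1 hx))).length_le
    omega
  push Not at hall
  obtain ⟨u, hu, huL⟩ := hall
  have gap : ∀ x, S x → x ∉ L → x ∈ U := by
    intro x hx hxL
    have := (hS x).2 hx
    rw [List.mem_append] at this
    exact this.resolve_left (fun h => hxL (l5 x h))
  have huU := gap u hu huL
  obtain ⟨v, w2, hv, b1, b2, b3⟩ := hB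
  have hvU : ∀ x ∈ U, ¬ R x v ∧ ¬ R v x := fun x hx =>
    ⟨fun h => f2 x hx ⟨v, w2, hv, h, b2, b3⟩, fun h => f1 x hx ⟨v, v, hv, b1, .refl, h⟩⟩
  have out1 : ∀ w, ¬ S w → ¬ (R u w ∧ R w v) := fun w hw h =>
    f2 u huU ⟨w, w2, hw, h.1, .head ⟨h.2, hv⟩ b2, b3⟩
  have out2 : ∀ w, ¬ S w → ¬ (R v w ∧ R w u) := fun w hw h =>
    f1 u huU ⟨v, w, hv, b1, .single ⟨h.1, hw⟩, h.2⟩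
  -- insertion bounds
  have bu := noins R u L (by
    rw [List.isChain_iff_forall_rel_of_append_cons_cons]
    rintro a b s t rfl ⟨h1, h2⟩
    have := hLmax (s ++ a :: u :: b :: t) ⟨?_, ?_, ?_, ?_, ?_, ?_⟩
    · simp at this
    · have : (s ++ a :: u :: b :: t).Perm (u :: (s ++ a :: b :: t)) := by
        have := List.perm_middle (a := u) (l₁ := s ++ [a]) (l₂ := b :: t)
        simpa using this
      rw [this.nodup_iff, List.nodup_cons]
      exact ⟨huL, l1⟩
    · simp [isChain_append_cons_cons, isChain_cons_cons] at l2 ⊢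
      tauto
    · simpa [List.getLast?_append, List.getLast?_cons] using l3
    · cases s <;> simpa using l4
    · intro x hx; have := l5 x hx; simp at this ⊢; tauto
    · intro x hx
      by_cases hxu : x = u
      · exact hxu ▸ hu
      · apply l6; simp at hx ⊢; tauto)
  have hvP : v ∉ P ++ U := fun h => hv ((hS v).1 h)
  have bv := noins R v P (by
    rw [List.isChain_iff_forall_rel_of_append_cons_cons]
    rintro a b s t rfl ⟨h1, h2⟩
    have := hmax (s ++ a :: v :: b :: t ++ U) ⟨?_, by simp, ?_⟩
    · simp at this
    · have : (s ++ a :: v :: b :: t ++ U).Perm (v :: (s ++ a :: b :: t ++ U)) := by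
        have := List.perm_middle (a := v) (l₁ := s ++ [a]) (l₂ := b :: t ++ U)
        simpa using this
      rw [this.nodup_iff, List.nodup_cons]
      exact ⟨hvP, hnd⟩
    · have h5 : Cyc R ((b :: t ++ U) ++ (s ++ [a])) := by
        apply cyc_rot; simpa using hcyc
      have h6 : IsChain R ((b :: t ++ U) ++ (s ++ [a])) := h5.2.2.left_of_append
      have h7 : Cyc R ((b :: t ++ U ++ s ++ [a]) ++ [v]) := by
        refine ⟨?_, by simp, ?_⟩
        · rw [(List.perm_append_comm).nodup_iff, List.singleton_append, List.nodup_cons]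
          refine ⟨fun h => hvP ?_, by simpa using h5.1⟩
          simp at h ⊢; tauto
        · have h6' : IsChain R (b :: t ++ U ++ s ++ [a]) := by simpa using h6
          rw [isChain_append]
          have h8 : IsChain R (b :: t ++ U ++ s ++ [a] ++ [v]) := by
            rw [isChain_append]; refine ⟨h6', by simp, ?_⟩
            rw [List.getLast?_append]; simpa using h1
          refine ⟨h8, h8, ?_⟩
          rw [List.getLast?_append]; simpa using h2
      have h9 : Cyc R ((b :: t ++ U) ++ (s ++ [a, v])) := by simpa using h7
      simpa using (cyc_rot h9).2.2)
  -- counting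
  have e1 := hd u v (hvU u huU).1
  have e2 := hd v u (hvU u huU).2
  set F : V → ℕ := fun w => ind (R u w) + ind (R w u) with hF
  set G : V → ℕ := fun w => ind (R v w) + ind (R w v) with hG
  have tot : 2 * (Fintype.card V + 2) ≤ ∑ w, (F w + G w) := by
    simp only [hF, hG, Finset.sum_add_distrib]; omega
  rw [← List.sum_toFinset _ l1] at bu
  rw [← List.sum_toFinset _ hnd.of_append_left] at bv
  have c1 : ∑ w ∈ L.toFinset, G w ≤ P.length + 1 := by
    refine le_trans (le_of_eq ?_) bv
    symm
    apply Finset.sum_subset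
    · intro x; simpa using l5 x
    · intro x hx hx'
      simp only [List.mem_toFinset] at hx hx'
      have : x ∈ U := by
        have := (hS x).2 (l6 x hx)
        rw [List.mem_append] at this
        tauto
      simp [ind_false (hvU x this).1, ind_false (hvU x this).2]
  have c2 : ∑ w ∈ L.toFinsetᶜ, (F w + G w) ≤ ∑ w ∈ L.toFinsetᶜ, 2 := by
    apply Finset.sum_le_sum
    intro w hw
    have hw : w ∉ L := by simpa using hw
    by_cases hs : S w
    · have := hvU w (gap w hs hw)
      have h1 := ind_le (R u w)
      have h2 := ind_le (R w u)
      simp only [hF, hG, ind_false this.1, ind_false this.2]; omega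
    · have h1 := ind_add_le (out1 w hs)
      have h2 := ind_add_le (out2 w hs)
      simp only [hF, hG]; omega
  have hPL : P.length ≤ L.length := (hnd.of_append_left.subperm l5).length_le
  have hLc : L.toFinset.card = L.length := List.toFinset_card_of_nodup l1
  rw [← Finset.sum_add_sum_compl L.toFinset, Finset.sum_add_distrib] at tot
  rw [Finset.sum_const, Finset.card_compl, hLc, smul_eq_mul] at c2
  have := l1.length_le_card
  have bu' : ∑ x ∈ L.toFinset, F x ≤ L.length + 1 := bu
  omega

theorem woodall [Fintype V] [Nonempty V] (R : V → V → Prop) (hr : ∀ x, R x x)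
    (hd : ∀ u v, ¬ R u v → Fintype.card V + 2 ≤ (∑ w, ind (R u w)) + ∑ w, ind (R w v)) :
    ∃ l : List V, Cyc R l ∧ ∀ x, x ∈ l := by
  obtain ⟨C, hC, hmax⟩ := maxlen (Cyc R) List.length (Fintype.card V)
    (fun l hl => hl.1.length_le_card)
    ⟨[Classical.arbitrary V], by simp, by simp, by simp [hr]⟩
  refine ⟨C, hC, ?_⟩
  by_contra! hz
  obtain ⟨z, hz⟩ := hz
  obtain ⟨p, hp, q, hq, hB⟩ := exists_byp C hC.2.1 z hz (R := R) (by
    intro u v huv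
    by_contra! hno
    have h1 := hd u v huv
    rw [← Finset.sum_add_distrib] at h1
    have h2 : ∑ w, (ind (R u w) + ind (R w v)) ≤ ∑ w : V, 1 :=
      Finset.sum_le_sum (fun w _ => ind_add_le (fun h => hno w h.1 h.2))
    simp only [Finset.sum_const, Finset.card_univ, smul_eq_mul] at h2
    omega)
  obtain ⟨P0, U0, hT0⟩ := exists_T hC hp hq hB
  obtain ⟨⟨P, U⟩, hT, hmin⟩ := minlen
    (fun PU : List V × List V => T R (fun x => x ∈ C) PU.1 PU.2) (fun PU => PU.2.length)
    ⟨(P0, U0), hT0⟩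
  refine key hr hd hT (fun P' U' h => hmin (P', U') h) ?_
  intro l hl
  refine (hmax l hl).trans ?_
  exact (hC.1.subperm (fun x hx => (hT.2.1 x).2 hx)).length_le


lemma cyc_get {R : V → V → Prop} {l : List V} (h : Cyc R l) (i : ℕ) (hi : i < l.length) :
    R (l[i]) (l[(i + 1) % l.length]'(Nat.mod_lt _ (by omega))) := by
  have h3 := List.isChain_iff_getElem.1 h.2.2 i (by simp; omega)
  rw [List.getElem_append_left hi] at h3
  by_cases h4 : i + 1 < l.length
  · rw [List.getElem_append_left h4] at h3
    simpa [Nat.mod_eq_of_lt h4] using h3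
  · have h5 : i + 1 = l.length := by omega
    rw [List.getElem_append_right (by omega)] at h3
    simpa [h5] using h3

lemma hall_step [Fintype V] [DecidableEq V]
    (A : V → V → Prop) [DecidableRel A] (X Y : Finset V) (a : ℕ)
    (hbip : IsBipartite A X Y) (hX : X.card = a) (hY : Y.card = a)
    (hdeg : ∀ u v : V, ((u ∈ X ∧ v ∈ Y) ∨ (u ∈ Y ∧ v ∈ X)) → ¬ A u v →
      a + 2 ≤ outDeg A u + inDeg A v) :
    ∃ f : X → V, Function.Injective f ∧ ∀ x : X, A x (f x) := by
  obtain ⟨hdis, hcov, harc⟩ := hbip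
  have hmemY : ∀ x ∈ X, ∀ y, A x y → y ∈ Y := by
    intro x hx y h
    rcases harc _ _ h with h | h
    · exact h.2
    · exact absurd h.1 (Finset.disjoint_left.1 hdis hx)
  have hmemX : ∀ y ∈ Y, ∀ x, A x y → x ∈ X := by
    intro y hy x h
    rcases harc _ _ h with h | h
    · exact h.1
    · exact absurd hy (Finset.disjoint_left.1 hdis h.2)
  have := (Finset.all_card_le_biUnion_card_iff_exists_injective
    (fun x : X => Finset.univ.filter (fun y => A x y))).1 ?_
  · obtain ⟨f, hf, h⟩ := this
    exact ⟨f, hf, fun x => by simpa using h x⟩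
  intro s
  by_contra! hlt
  set N := s.biUnion (fun x : X => Finset.univ.filter (fun y => A x y)) with hN
  have hs : s.Nonempty := by
    rw [Finset.nonempty_iff_ne_empty]; rintro rfl; simp at hlt
  obtain ⟨x, hx⟩ := hs
  have hsa : s.card ≤ a := by
    have := Finset.card_le_univ s
    simpa [hX] using this
  obtain ⟨y, hy, hyN⟩ : ∃ y ∈ Y, y ∉ N := by
    by_contra! h
    have := Finset.card_le_card (show Y ⊆ N from h)
    omega
  have hno : ∀ x ∈ s, ¬ A x y := by
    intro x hx h
    exact hyN (by rw [hN, Finset.mem_biUnion]; exact ⟨x, hx, by simpa using h⟩)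
  have h1 := hdeg x y (Or.inl ⟨x.2, hy⟩) (hno x hx)
  have h2 : outDeg A x ≤ N.card := Finset.card_le_card
    (Finset.subset_biUnion_of_mem (fun x : X => Finset.univ.filter (fun y => A x y)) hx)
  have h3 : inDeg A y ≤ (X \ s.map (Function.Embedding.subtype _)).card := by
    apply Finset.card_le_card
    intro w hw
    have hw : A w y := by simpa using hw
    rw [Finset.mem_sdiff]
    refine ⟨hmemX y hy w hw, fun h => ?_⟩
    rw [Finset.mem_map] at h
    obtain ⟨z, hz, rfl⟩ := h
    exact hno z hz hw
  rw [Finset.card_sdiff_of_subset (by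
    intro w hw
    rw [Finset.mem_map] at hw
    obtain ⟨z, hz, rfl⟩ := hw
    exact z.2), Finset.card_map] at h3
  omega

lemma sum_ind {W : Type*} [Fintype W] (p : W → Prop) [DecidablePred p] :
    ∑ w, ind (p w) = (Finset.univ.filter p).card := by
  rw [Finset.card_filter]
  apply Finset.sum_congr rfl
  intro w _
  by_cases h : p w <;> simp [ind, h]

end HC

theorem stmt_1 {V : Type*} [Fintype V] [DecidableEq V]
    (A : V → V → Prop) [DecidableRel A] (X Y : Finset V) (a : ℕ)
    (ha : 2 ≤ a) (hbip : IsBipartite A X Y) (hX : X.card = a) (hY : Y.card = a)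
    (hdeg : ∀ u v : V, ((u ∈ X ∧ v ∈ Y) ∨ (u ∈ Y ∧ v ∈ X)) → ¬ A u v →
      a + 2 ≤ outDeg A u + inDeg A v) :
    ∃ p : ℕ → V, IsCycle A (2 * a) p ∧ ∀ v : V, ∃ i < 2 * a, p i = v := by
  classical
  obtain ⟨f, hf, hA⟩ := HC.hall_step A X Y a hbip hX hY hdeg
  obtain ⟨hdis, hcov, harc⟩ := hbip
  have hfY : ∀ x, f x ∈ Y := by
    intro x
    rcases harc _ _ (hA x) with h | h
    · exact h.2
    · exact absurd h.1 (Finset.disjoint_left.1 hdis x.2)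
  have hsurj : ∀ y ∈ Y, ∃ x, f x = y := by
    have h1 : Finset.univ.image f = Y := by
      apply Finset.eq_of_subset_of_card_le
      · intro y hy
        obtain ⟨x, _, rfl⟩ := Finset.mem_image.1 hy
        exact hfY x
      · rw [Finset.card_image_of_injective _ hf]; simp [hX, hY]
    intro y hy
    rw [← h1] at hy
    obtain ⟨x, _, rfl⟩ := Finset.mem_image.1 hy
    exact ⟨x, rfl⟩
  have hcard : Fintype.card X = a := by simp [hX]
  haveI : Nonempty X := Fintype.card_pos_iff.1 (by omega)
  obtain ⟨l, hl, hall⟩ := HC.woodall (V := X) (fun i j => i = j ∨ A (f i) j) (fun x => Or.inl rfl) (by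
    intro u v huv
    push Not at huv
    have h1 := hdeg (f u) v (Or.inr ⟨hfY u, v.2⟩) huv.2
    rw [HC.sum_ind, HC.sum_ind, hcard]
    refine h1.trans (Nat.add_le_add ?_ ?_)
    · refine (Finset.card_le_card ?_).trans (Finset.card_image_le (f := Subtype.val))
      intro w hw
      have hw : A (f u) w := by simpa using hw
      have hwX : w ∈ X := by
        rcases harc _ _ hw with h | h
        · exact absurd (hfY u) (Finset.disjoint_left.1 hdis h.1)
        · exact h.2
      rw [Finset.mem_image]
      exact ⟨⟨w, hwX⟩, by simp [hw], rfl⟩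
    · refine (Finset.card_le_card ?_).trans (Finset.card_image_le (f := f))
      intro w hw
      have hw : A w v := by simpa using hw
      have hwY : w ∈ Y := by
        rcases harc _ _ hw with h | h
        · exact absurd h.2 (Finset.disjoint_left.1 hdis v.2)
        · exact h.1
      obtain ⟨x, rfl⟩ := hsurj w hwY
      rw [Finset.mem_image]
      exact ⟨x, by simp [hw], rfl⟩)
  have hlen : l.length = a := by
    rw [← hcard, ← List.toFinset_card_of_nodup hl.1, ← Finset.card_univ]
    congr 1
    ext x; simp [hall x]
  let g : ℕ → X := fun i => l[i % a]'(by rw [hlen]; exact Nat.mod_lt _ (by omega))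
  have ginj : ∀ i j, i < a → j < a → g i = g j → i = j := by
    intro i j hi hj h
    have := (hl.1.getElem_inj_iff).1 h
    rwa [Nat.mod_eq_of_lt hi, Nat.mod_eq_of_lt hj] at this
  have gsurj : ∀ x, ∃ i < a, g i = x := by
    intro x
    obtain ⟨i, hi, h⟩ := List.getElem_of_mem (hall x)
    refine ⟨i, by omega, ?_⟩
    simp only [g, Nat.mod_eq_of_lt (show i < a by omega), h]
  have gmod : ∀ i, g (i % a) = g i := by intro i; simp [g]
  have garc : ∀ i < a, A (f (g i)) (g (i + 1)) := by
    intro i hi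
    have h1 := HC.cyc_get hl i (by omega)
    have h2 : l[i] = g i := by simp [g, Nat.mod_eq_of_lt hi]
    have h3 : (l[(i + 1) % l.length]'(Nat.mod_lt _ (by omega))) = g (i + 1) := by simp [g, hlen]
    rw [h2, h3] at h1
    rcases h1 with h1 | h1
    · rw [← gmod (i + 1)] at h1
      have h4 := ginj i _ hi (Nat.mod_lt _ (by omega)) h1
      by_cases h5 : i + 1 < a
      · rw [Nat.mod_eq_of_lt h5] at h4; omega
      · have : i + 1 = a := by omega
        rw [this, Nat.mod_self] at h4; omega
    · exact h1
  let p : ℕ → V := fun k => if k % 2 = 0 then (g (k / 2) : V) else f (g (k / 2))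
  have pe : ∀ i, p (2 * i) = g i := by
    intro i
    simp [p]
  have po : ∀ i, p (2 * i + 1) = f (g i) := by
    intro i
    have h1 : (2 * i + 1) % 2 = 1 := by omega
    have h2 : (2 * i + 1) / 2 = i := by omega
    simp [p, h2]
  have hne : ∀ i j, (g i : V) ≠ f (g j) := fun i j h =>
    Finset.disjoint_left.1 hdis (g i).2 (h ▸ hfY (g j))
  refine ⟨p, ⟨?_, ?_⟩, ?_⟩
  · intro i hi j hj hij
    simp only [Set.mem_Iio] at hi hj
    obtain ⟨i', rfl | rfl⟩ := Nat.even_or_odd' i <;> obtain ⟨j', rfl | rfl⟩ := Nat.even_or_odd' j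
    · rw [pe, pe] at hij
      have := ginj i' j' (by omega) (by omega) (Subtype.ext hij)
      omega
    · rw [pe, po] at hij; exact absurd hij (hne _ _)
    · rw [pe, po] at hij; exact absurd hij.symm (hne _ _)
    · rw [po, po] at hij
      have := ginj i' j' (by omega) (by omega) (hf hij)
      omega
  · intro i hi
    obtain ⟨i', rfl | rfl⟩ := Nat.even_or_odd' i
    · rw [Nat.mod_eq_of_lt (by omega), pe, po]
      exact hA _
    · have : (2 * i' + 1 + 1) % (2 * a) = 2 * ((i' + 1) % a) := by
        rw [← Nat.mul_mod_mul_left, Nat.mul_add]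
      rw [this, po, pe, gmod]
      exact garc i' (by omega)
  · intro v
    rcases hcov v with h | h
    · obtain ⟨i, hi, hg⟩ := gsurj ⟨v, h⟩
      exact ⟨2 * i, by omega, by rw [pe, hg]⟩
    · obtain ⟨x, rfl⟩ := hsurj v h
      obtain ⟨i, hi, hg⟩ := gsurj x
      exact ⟨2 * i + 1, by omega, by rw [po, hg]⟩
end

section
/- Let D be a digraph on n ≥ 3 vertices such that d^+(x) + d^-(y) ≥ n for every ordered pair of distinct vertices x, y with xy not an arc of D. Then D contains a Hamiltonian oriented cycle (an oriented cycle through all n vertices). -/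
open Finset

namespace W8

def Cyc {V : Type*} (A : V → V → Prop) (c : V) (l : List V) : Prop :=
  List.IsChain A (c :: (l ++ [c])) ∧ (c :: l).Nodup

lemma Cyc.rot {V : Type*} {A : V → V → Prop} {c x : V} {s t : List V}
    (h : Cyc A c (s ++ x :: t)) : Cyc A x (t ++ c :: s) := by
  obtain ⟨h1, h2⟩ := h
  have e1 : c :: ((s ++ x :: t) ++ [c]) = (c :: s) ++ x :: (t ++ [c]) := by simp
  have e2 : x :: ((t ++ c :: s) ++ [x]) = (x :: t) ++ c :: (s ++ [x]) := by simp
  refine ⟨?_, ?_⟩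
  · rw [e1, List.isChain_split] at h1
    rw [e2, List.isChain_split]
    exact ⟨h1.2, h1.1⟩
  · have : (x :: (t ++ c :: s)).Perm (c :: (s ++ x :: t)) := by
      have := List.perm_append_comm (l₁ := x :: t) (l₂ := c :: s)
      simpa using this
    exact this.nodup_iff.2 h2

lemma perm_rot {V : Type*} (c x : V) (s t : List V) :
    (x :: (t ++ c :: s)).Perm (c :: (s ++ x :: t)) := by
  have := List.perm_append_comm (l₁ := x :: t) (l₂ := c :: s)
  simpa using this

lemma Cyc.rot_mem {V : Type*} {A : V → V → Prop} {a c : V} {l : List V}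
    (h : Cyc A a l) (hc : c ∈ a :: l) : ∃ l', Cyc A c l' ∧ (c :: l').Perm (a :: l) := by
  rcases List.mem_cons.1 hc with rfl | hc
  · exact ⟨l, h, List.Perm.refl _⟩
  · obtain ⟨s, t, rfl⟩ := List.append_of_mem hc
    exact ⟨_, h.rot, perm_rot _ _ _ _⟩

lemma exists_path {V : Type*} {A : V → V → Prop} {S : V → Prop} {u v : V} (hv : S v)
    (h : Relation.ReflTransGen (fun a b => A a b ∧ S a ∧ S b) u v) :
    ∃ Q : List V, Q.Nodup ∧ Q.IsChain A ∧ (∀ q ∈ Q, S q) ∧ Q.head? = some u ∧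
      Q.getLast? = some v := by
  induction h using Relation.ReflTransGen.head_induction_on with
  | refl => exact ⟨[v], by simp, by simp, by simpa using hv, by simp, by simp⟩
  | @head a b hab hbv ih =>
    obtain ⟨Q, h1, h2, h3, h4, h5⟩ := ih
    by_cases ha : a ∈ Q
    · obtain ⟨s, t, rfl⟩ := List.append_of_mem ha
      refine ⟨a :: t, ?_, ?_, ?_, by simp, ?_⟩
      · exact (List.nodup_append.1 h1).2.1
      · exact (List.isChain_append.1 h2).2.1
      · intro q hq; exact h3 q (by simp at hq ⊢; tauto)
      · simpa [List.getLast?_append] using h5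
    · refine ⟨a :: Q, by simp [ha, h1], ?_, ?_, by simp, ?_⟩
      · rw [List.isChain_cons]
        refine ⟨?_, h2⟩
        intro y hy
        rw [h4] at hy
        simp at hy; subst hy; exact hab.1
      · intro q hq
        rcases List.mem_cons.1 hq with rfl | hq
        · exact hab.2.1
        · exact h3 q hq
      · rw [List.getLast?_cons, h5]; simp

section
variable {V : Type*} (A : V → V → Prop) [DecidableRel A]

def g (v w : V) : ℕ := (if A v w then 1 else 0) + (if A w v then 1 else 0)

lemma g_le (v w : V) : g A v w ≤ 2 := by unfold g; split_ifs <;> omega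

lemma count_aux (v : V) : ∀ (P : List V) (a : V)
    (_ : ∀ s t x y, a :: P = s ++ x :: y :: t → ¬ (A x v ∧ A v y)),
    ((a :: P).map (g A v)).sum ≤ P.length + 1 + (if A v a then 1 else 0)
  | [], a, _ => by simp [g]; split_ifs <;> omega
  | b :: P, a, h => by
    have ih := count_aux v P b (fun s t x y e => h (a :: s) t x y (by rw [e]; rfl))
    have h0 := h [] P a b rfl
    rw [List.map_cons, List.sum_cons]
    simp only [List.length_cons]
    unfold g at *
    split_ifs at * <;> first | omega | tauto

variable [Fintype V]

lemma sum_g (v : V) : ∑ w, g A v w = outDeg A v + inDeg A v := by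
  simp only [g, outDeg, inDeg, Finset.sum_add_distrib, Finset.card_filter]

end

lemma count_fin {V : Type*} (A : V → V → Prop) [DecidableRel A] [DecidableEq V] (v : V) (P : List V)
    (hn : P.Nodup)
    (h : ∀ s t x y, P = s ++ x :: y :: t → ¬ (A x v ∧ A v y)) :
    ∑ w ∈ P.toFinset, g A v w ≤ P.length + 1 := by
  rw [List.sum_toFinset _ hn]
  change (P.map (g A v)).sum ≤ _
  cases P with
  | nil => simp
  | cons a P =>
    have := count_aux A v P a h
    simp only [List.length_cons]
    split_ifs at this <;> omega

end W8

open W8 in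
set_option maxHeartbeats 4000000 in
theorem stmt_8 {V : Type*} [Fintype V] [DecidableEq V]
    (A : V → V → Prop) [DecidableRel A] (hirr : ∀ v : V, ¬ A v v)
    (hn : 3 ≤ Fintype.card V)
    (hdeg : ∀ x y : V, x ≠ y → ¬ A x y →
      Fintype.card V ≤ outDeg A x + inDeg A y) :
    ∃ p : ℕ → V, IsCycle A (Fintype.card V) p ∧
      ∀ v : V, ∃ i < Fintype.card V, p i = v := by
  -- directed diameter two
  have diam : ∀ x y : V, x ≠ y → A x y ∨ ∃ z, A x z ∧ A z y := by
    intro x y hxy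
    by_contra hcon
    push Not at hcon
    have h1 := hdeg x y hxy hcon.1
    have hd : Disjoint (univ.filter (fun w => A x w)) (univ.filter (fun w => A w y)) := by
      rw [Finset.disjoint_left]
      intro w hw hw'
      simp at hw hw'
      exact hcon.2 w hw hw'
    have h2 : (univ.filter (fun w => A x w) ∪ univ.filter (fun w => A w y)).card
        ≤ (univ.erase x).card := by
      apply Finset.card_le_card
      intro w hw
      simp at hw ⊢
      rintro rfl
      rcases hw with h | h
      · exact hirr _ h
      · exact hcon.1 h
    rw [Finset.card_union_of_disjoint hd, Finset.card_erase_of_mem (mem_univ _),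
      Finset.card_univ] at h2
    unfold outDeg inDeg at h1
    omega
  -- nonadjacent pairs
  have nonadj : ∀ u x : V, u ≠ x → ¬ A u x → ¬ A x u →
      2 * Fintype.card V ≤ ∑ w, (g A u w + g A x w) := by
    intro u x h h1 h2
    have := hdeg u x h h1
    have := hdeg x u h.symm h2
    rw [Finset.sum_add_distrib, sum_g, sum_g]
    omega
  -- longest cycle
  obtain ⟨c₀, l₀, hcyc, hmax⟩ : ∃ c l, Cyc A c l ∧ ∀ c' l', Cyc A c' l' → l'.length ≤ l.length := by
    have hex : ∃ k, ∃ c l, Cyc A c l ∧ l.length = k := by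
      obtain ⟨x, y, hxy⟩ := Fintype.exists_pair_of_one_lt_card (α := V) (by omega)
      obtain ⟨a, b, hab⟩ : ∃ a b, A a b := by
        rcases diam x y hxy with h | ⟨z, h, _⟩
        · exact ⟨_, _, h⟩
        · exact ⟨_, _, h⟩
      have hne : a ≠ b := by rintro rfl; exact hirr _ hab
      rcases diam b a hne.symm with h | ⟨z, h, h'⟩
      · exact ⟨_, a, [b], ⟨by simp [hab, h], by simp [hne]⟩, rfl⟩
      · have : b ≠ z := by rintro rfl; exact hirr _ h
        have : a ≠ z := by rintro rfl; exact hirr _ h'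
        exact ⟨_, a, [b, z], ⟨by simp [hab, h, h'], by simp [*]⟩, rfl⟩
    have hb : ∀ k, (∃ c l, Cyc A c l ∧ l.length = k) → k ≤ Fintype.card V := by
      rintro k ⟨c, l, h, rfl⟩
      have := h.2.length_le_card
      simp at this; omega
    classical
    obtain ⟨k, hk⟩ := hex
    obtain ⟨c, l, h, hl⟩ := Nat.findGreatest_spec
      (P := fun k => ∃ c l, Cyc A c l ∧ l.length = k) (hb k hk) hk
    refine ⟨c, l, h, fun c' l' h' => ?_⟩
    rw [hl]
    exact Nat.le_findGreatest (hb _ ⟨c', l', h', rfl⟩) ⟨c', l', h', rfl⟩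
  have hne0 : l₀ ≠ [] := by
    rintro rfl
    have := hcyc.1
    simp at this
    exact hirr _ this
  by_cases hall : (c₀ :: l₀).length = Fintype.card V
  · -- Hamiltonian
    refine ⟨fun i => (c₀ :: l₀).getD i c₀, ⟨?_, ?_⟩, ?_⟩
    · intro i hi j hj hij
      simp only [Set.mem_Iio, ← hall] at hi hj
      simp only [List.getD_eq_getElem _ _ hi, List.getD_eq_getElem _ _ hj] at hij
      exact (hcyc.2.getElem_inj_iff).1 hij
    · intro i hi
      rw [← hall] at hi ⊢
      have hch := List.isChain_iff_getElem.1 hcyc.1 i (by simp at hi ⊢; omega)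
      have e : c₀ :: (l₀ ++ [c₀]) = (c₀ :: l₀) ++ [c₀] := rfl
      simp only [e] at hch
      rw [List.getElem_append_left hi] at hch
      simp only [List.getD_eq_getElem _ _ hi]
      rcases Nat.lt_or_ge (i + 1) (c₀ :: l₀).length with h | h
      · rw [List.getElem_append_left h] at hch
        rw [Nat.mod_eq_of_lt h, List.getD_eq_getElem _ _ h]
        exact hch
      · rw [List.getElem_append_right h] at hch
        have h3 : i + 1 = (c₀ :: l₀).length := by omega
        rw [h3, Nat.mod_self]
        simpa using hch
    · intro v
      have : (c₀ :: l₀).toFinset = univ := by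
        apply Finset.eq_univ_of_card
        rw [List.toFinset_card_of_nodup hcyc.2, hall]
      have hv : v ∈ c₀ :: l₀ := by rw [← List.mem_toFinset, this]; exact mem_univ _
      obtain ⟨i, hi, h⟩ := List.getElem_of_mem hv
      exact ⟨i, hall ▸ hi, by simp only [List.getD_eq_getElem _ _ hi, h]⟩
  exfalso
  obtain ⟨C, hC⟩ : ∃ C : Finset V, C = (c₀ :: l₀).toFinset := ⟨_, rfl⟩
  have hCcard : C.card = l₀.length + 1 := by
    rw [hC, List.toFinset_card_of_nodup hcyc.2]; simp
  have hCn : Cᶜ.card + C.card = Fintype.card V := by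
    rw [Finset.card_compl]
    have := Finset.card_le_univ C
    omega
  obtain ⟨u₀, hu₀⟩ : ∃ u, u ∉ C := by
    by_contra hcon
    push Not at hcon
    apply hall
    have : C = univ := Finset.eq_univ_iff_forall.2 hcon
    rw [List.length_cons, ← hCcard, this, Finset.card_univ]
  let r : V → V → Prop := fun a b => A a b ∧ a ∉ C ∧ b ∉ C
  -- bound on the outside
  have outside : ∀ u x, u ∉ C → ¬ A u x → ¬ A x u →
      (∀ w, w ∉ C → ¬ (A u w ∧ A w x)) → (∀ w, w ∉ C → ¬ (A x w ∧ A w u)) →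
      ∑ w ∈ Cᶜ, (g A u w + g A x w) + 2 ≤ 2 * Cᶜ.card := by
    intro u x hu h1 h2 h3 h4
    have hu' : u ∈ Cᶜ := by simpa using hu
    rw [← Finset.add_sum_erase _ _ hu']
    have e0 : g A u u + g A x u = 0 := by simp [g, hirr, h1, h2]
    have : ∑ w ∈ Cᶜ.erase u, (g A u w + g A x w) ≤ (Cᶜ.erase u).card • 2 := by
      apply Finset.sum_le_card_nsmul
      intro w hw
      simp at hw
      have := h3 w hw.2
      have := h4 w hw.2
      unfold g
      split_ifs <;> first | omega | tauto
    rw [Finset.card_erase_of_mem hu'] at this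
    have := Finset.card_pos.2 ⟨u, hu'⟩
    simp only [smul_eq_mul] at *
    omega
  by_cases hbyp : ∃ c ∈ C, ∃ c' ∈ C, c ≠ c' ∧ ∃ u v, u ∉ C ∧ v ∉ C ∧ A c u ∧
      Relation.ReflTransGen r u v ∧ A v c'
  · have hgap : ∃ k, ∃ (c : V) (X : List V) (c' : V) (Y : List V) (u v : V),
        Cyc A c (X ++ c' :: Y) ∧ (c :: (X ++ c' :: Y)).Perm (c₀ :: l₀) ∧
        u ∉ C ∧ v ∉ C ∧ A c u ∧ Relation.ReflTransGen r u v ∧ A v c' ∧ X.length = k := by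
      obtain ⟨c, hc, c', hc', hne, u, v, h⟩ := hbyp
      rw [hC, List.mem_toFinset] at hc hc'
      obtain ⟨l', hl', hp⟩ := hcyc.rot_mem hc
      have : c' ∈ c :: l' := hp.mem_iff.2 hc'
      rcases List.mem_cons.1 this with h' | h'
      · exact absurd h'.symm hne
      obtain ⟨s, t, rfl⟩ := List.append_of_mem h'
      exact ⟨_, c, s, c', t, u, v, hl', hp, h.1, h.2.1, h.2.2.1, h.2.2.2.1, h.2.2.2.2, rfl⟩
    classical
    obtain ⟨c, X, c', Y, u, v, hcy, hp, hu, hv, hcu, huv, hvc, hk⟩ := Nat.find_spec hgap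
    have hmin : ∀ (c : V) (X' : List V) (c' : V) (Y : List V) (u v : V),
        Cyc A c (X' ++ c' :: Y) → (c :: (X' ++ c' :: Y)).Perm (c₀ :: l₀) →
        u ∉ C → v ∉ C → A c u → Relation.ReflTransGen r u v → A v c' →
        X.length ≤ X'.length := by
      intro c X' c' Y u v h1 h2 h3 h4 h5 h6 h7
      rw [hk]
      exact Nat.find_min' hgap ⟨c, X', c', Y, u, v, h1, h2, h3, h4, h5, h6, h7, rfl⟩
    clear hk
    have hmemC : ∀ w, w ∈ C ↔ w ∈ c :: (X ++ c' :: Y) := by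
      intro w; rw [hC, List.mem_toFinset, hp.mem_iff]
    have hlen : l₀.length = X.length + Y.length + 1 := by
      have := hp.length_eq
      simp at this; omega
    -- arcs into the gap
    have noOut : ∀ x ∈ X, ∀ w, w ∉ C → Relation.ReflTransGen r u w → ¬ A w x := by
      intro x hx w hw huw hwx
      obtain ⟨s, t, rfl⟩ := List.append_of_mem hx
      have := hmin c s x (t ++ c' :: Y) u w (by simpa using hcy) (by simpa using hp) hu hw hcu huw hwx
      simp at this
    have noIn : ∀ x ∈ X, ∀ w, w ∉ C → Relation.ReflTransGen r w u → ¬ A x w := by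
      intro x hx w hw hwu hxw
      obtain ⟨s, t, rfl⟩ := List.append_of_mem hx
      have e : (s ++ x :: t) ++ c' :: Y = s ++ x :: (t ++ c' :: Y) := by simp
      rw [e] at hcy hp
      have := hmin x t c' (Y ++ c :: s) w v (by simpa using hcy.rot)
        (by simpa using (perm_rot _ _ _ _).trans hp) hw hv hxw (hwu.trans huv) hvc
      simp at this
      omega
    obtain ⟨Q, hQn, hQc, hQS, hQh, hQl⟩ := exists_path (S := fun a => a ∉ C) hv huv
    have hQne : Q ≠ [] := by rintro rfl; simp at hQh
    -- base path
    have hP0n : (c' :: (Y ++ [c])).Nodup := by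
      have := hcy.rot.2
      rw [show c' :: (Y ++ c :: X) = (c' :: (Y ++ [c])) ++ X by simp] at this
      exact (List.nodup_append.1 this).1
    have hP0c : (c' :: (Y ++ [c])).IsChain A := by
      have := hcy.rot.1
      rw [show c' :: ((Y ++ c :: X) ++ [c']) = (c' :: (Y ++ [c])) ++ (X ++ [c']) by simp] at this
      exact (List.isChain_append.1 this).1
    -- good paths
    let Good : List V → Prop := fun P => P.Nodup ∧ P.IsChain A ∧ P.head? = some c' ∧
      P.getLast? = some c ∧ (∀ w ∈ P, w ∈ C) ∧ (∀ w ∈ c' :: (Y ++ [c]), w ∈ P)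
    have hG0 : Good (c' :: (Y ++ [c])) := by
      refine ⟨hP0n, hP0c, by simp, ?_, ?_, fun w h => h⟩
      · rw [← List.cons_append]; simp only [List.getLast?_concat]
      · intro w hw; rw [hmemC]; simp at hw ⊢; tauto
    obtain ⟨P, hP, hPmax⟩ : ∃ P, Good P ∧ ∀ P', Good P' → P'.length ≤ P.length := by
      have hb : ∀ k, (∃ P, Good P ∧ P.length = k) → k ≤ Fintype.card V := by
        rintro k ⟨P, h, rfl⟩
        exact h.1.length_le_card
      obtain ⟨P, h, hl⟩ := Nat.findGreatest_spec
        (P := fun k => ∃ P, Good P ∧ P.length = k) (hb _ ⟨_, hG0, rfl⟩) ⟨_, hG0, rfl⟩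
      refine ⟨P, h, fun P' h' => ?_⟩
      rw [hl]
      exact Nat.le_findGreatest (hb _ ⟨P', h', rfl⟩) ⟨P', h', rfl⟩
    obtain ⟨hPn, hPc, hPh, hPl, hPC, hP0⟩ := hP
    have hPsub : P.toFinset ⊆ C := by
      intro w hw; exact hPC w (List.mem_toFinset.1 hw)
    have hPcard : P.toFinset.card = P.length := List.toFinset_card_of_nodup hPn
    -- some vertex not on P
    obtain ⟨x, hxC, hxP⟩ : ∃ x ∈ C, x ∉ P := by
      by_contra hcon
      push Not at hcon
      have h1 : C.card ≤ P.length := by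
        rw [← hPcard]
        exact Finset.card_le_card (fun w hw => List.mem_toFinset.2 (hcon w hw))
      obtain ⟨P1, rfl⟩ : ∃ P1, P = c' :: P1 := by
        cases P with
        | nil => simp at hPh
        | cons a P1 => simp at hPh; subst hPh; exact ⟨P1, rfl⟩
      have hbig : Cyc A c' (P1 ++ Q) := by
        refine ⟨?_, ?_⟩
        · rw [show c' :: (P1 ++ Q ++ [c']) = (c' :: P1) ++ (Q ++ [c']) by simp]
          refine List.isChain_append.2 ⟨hPc, List.isChain_append.2 ⟨hQc, by simp, ?_⟩, ?_⟩
          · intro a ha b hb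
            rw [hQl] at ha
            simp at ha hb
            subst ha; subst hb; exact hvc
          · intro a ha b hb
            rw [hPl] at ha
            rw [List.head?_append_of_ne_nil _ hQne, hQh] at hb
            simp at ha hb
            subst ha; subst hb; exact hcu
        · rw [← List.cons_append]
          refine List.nodup_append.2 ⟨hPn, hQn, ?_⟩
          intro a ha b hb hab
          subst hab
          exact hQS _ hb (hPC _ ha)
      have h2 := hmax _ _ hbig
      have h3 := List.length_pos_iff.2 hQne
      simp at h1 h2
      omega
    have hxX : x ∈ X := by
      have h1 := (hmemC x).1 hxC
      have h2 : x ∉ c' :: (Y ++ [c]) := fun h => hxP (hP0 x h)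
      simp at h1 h2
      tauto
    have hux : u ≠ x := by rintro rfl; exact hu hxC
    have hAux : ¬ A u x := noOut x hxX u hu .refl
    have hAxu : ¬ A x u := noIn x hxX u hu .refl
    have H := nonadj u x hux hAux hAxu
    have H1 := outside u x hu hAux hAxu
      (fun w hw h => noOut x hxX w hw (.single ⟨h.1, hu, hw⟩) h.2)
      (fun w hw h => noIn x hxX w hw (.single ⟨h.2, hw, hu⟩) h.1)
    -- u versus base path
    have H2 : ∑ w ∈ C, g A u w ≤ Y.length + 3 := by
      have h1 : ∑ w ∈ (c' :: (Y ++ [c])).toFinset, g A u w = ∑ w ∈ C, g A u w := by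
        apply Finset.sum_subset
        · intro w hw; rw [List.mem_toFinset] at hw; rw [hmemC]; simp at hw ⊢; tauto
        · intro w hw hw'
          have hwX : w ∈ X := by
            rw [hmemC] at hw; rw [List.mem_toFinset] at hw'
            simp at hw hw'; tauto
          simp [g, noOut w hwX u hu .refl, noIn w hwX u hu .refl]
      rw [← h1]
      refine (count_fin A u _ hP0n ?_).trans (by simp)
      rintro s t a b e ⟨h2, h3⟩
      have hc2 := hcy.rot
      have hch := hc2.1
      have hnd := hc2.2
      have hu2 : u ∉ c' :: (Y ++ c :: X) := by
        intro h; apply hu; rw [hmemC]; simp at h ⊢; tauto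
      rw [show c' :: (Y ++ c :: X) = (c' :: (Y ++ [c])) ++ X by simp, e] at hnd hu2
      rw [show c' :: ((Y ++ c :: X) ++ [c']) = (c' :: (Y ++ [c])) ++ (X ++ [c']) by simp, e] at hch
      have hc3 : List.IsChain A (s ++ a :: u :: b :: (t ++ X ++ [c'])) := by
        have hch' : List.IsChain A (s ++ a :: (b :: (t ++ X ++ [c']))) := by simpa using hch
        rw [List.isChain_split] at hch' ⊢
        refine ⟨hch'.1, ?_⟩
        have := hch'.2
        simp only [List.isChain_cons_cons] at this ⊢
        exact ⟨h2, h3, this.2⟩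
      have hn3 : (s ++ a :: u :: b :: (t ++ X)).Nodup := by
        have hpm : (s ++ a :: u :: b :: (t ++ X)).Perm (u :: ((s ++ a :: b :: t) ++ X)) := by
          have := List.perm_middle (a := u) (l₁ := s ++ [a]) (l₂ := b :: (t ++ X))
          simpa using this
        rw [hpm.nodup_iff, List.nodup_cons]
        exact ⟨hu2, hnd⟩
      have hel : (s ++ a :: b :: t).length = Y.length + 2 := by rw [← e]; simp
      have : ∃ m, Cyc A c' m ∧ m.length = Y.length + X.length + 2 := by
        cases s with
        | nil =>
          simp at e
          obtain ⟨rfl, e⟩ := e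
          refine ⟨u :: b :: (t ++ X), ⟨by simpa using hc3, by simpa using hn3⟩, ?_⟩
          simp at hel ⊢; omega
        | cons d s =>
          simp at e
          obtain ⟨rfl, e⟩ := e
          refine ⟨s ++ a :: u :: b :: (t ++ X), ⟨by simpa using hc3, by simpa using hn3⟩, ?_⟩
          simp at hel ⊢; omega
      obtain ⟨m, hm, hml⟩ := this
      have := hmax _ _ hm
      omega
    -- x versus P
    have H3 : ∑ w ∈ P.toFinset, g A x w ≤ P.length + 1 := by
      refine count_fin A x _ hPn ?_
      rintro s t a b rfl ⟨h2, h3⟩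
      have hpm : (s ++ a :: x :: b :: t).Perm (x :: (s ++ a :: b :: t)) := by
        have := List.perm_middle (a := x) (l₁ := s ++ [a]) (l₂ := b :: t)
        simpa using this
      have : Good (s ++ a :: x :: b :: t) := by
        refine ⟨?_, ?_, ?_, ?_, ?_, ?_⟩
        · rw [hpm.nodup_iff, List.nodup_cons]; exact ⟨hxP, hPn⟩
        · rw [List.isChain_split] at hPc ⊢
          refine ⟨hPc.1, ?_⟩
          have := hPc.2
          simp only [List.isChain_cons_cons] at this ⊢
          exact ⟨h2, h3, this.2⟩
        · cases s <;> simpa using hPh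
        · simpa [List.getLast?_append, List.getLast?_cons] using hPl
        · intro w hw
          rw [hpm.mem_iff] at hw
          rcases List.mem_cons.1 hw with rfl | hw
          · exact hxC
          · exact hPC w hw
        · intro w hw
          rw [hpm.mem_iff]
          exact List.mem_cons_of_mem _ (hP0 w hw)
      have := hPmax _ this
      simp at this
    have hxd : x ∈ C \ P.toFinset := by simp [hxC, hxP]
    have H4 : ∑ w ∈ C \ P.toFinset, g A x w + 2 ≤ 2 * (C \ P.toFinset).card := by
      rw [← Finset.add_sum_erase _ _ hxd]
      have e0 : g A x x = 0 := by simp [g, hirr]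
      have := Finset.sum_le_card_nsmul ((C \ P.toFinset).erase x) (fun w => g A x w) 2 (fun w _ => g_le A x w)
      rw [Finset.card_erase_of_mem hxd] at this
      have := Finset.card_pos.2 ⟨x, hxd⟩
      simp only [smul_eq_mul] at *
      omega
    have H5 := Finset.sum_sdiff (f := fun w => g A x w) hPsub
    have H6 := Finset.card_sdiff_add_card_eq_card hPsub
    have H7 := Finset.sum_compl_add_sum C (fun w => g A u w + g A x w)
    rw [Finset.sum_add_distrib (s := C)] at H7
    have H8 := hPmax _ hG0
    simp at H8
    omega
  · -- no bypass
    have hc₀ : c₀ ∈ C := by simp [hC]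
    have hne : ∀ c ∈ C, c ≠ u₀ := by rintro c hc rfl; exact hu₀ hc
    obtain ⟨c, hc, u, hu, hcu, huu⟩ : ∃ c ∈ C, ∃ u, u ∉ C ∧ A c u ∧ Relation.ReflTransGen r u u₀ := by
      rcases diam c₀ u₀ (hne _ hc₀) with h | ⟨z, h, h'⟩
      · exact ⟨c₀, hc₀, u₀, hu₀, h, .refl⟩
      · by_cases hz : z ∈ C
        · exact ⟨z, hz, u₀, hu₀, h', .refl⟩
        · exact ⟨c₀, hc₀, z, hz, h, .single ⟨h', hz, hu₀⟩⟩
    obtain ⟨c', hc', v, hv, hvc, huv⟩ : ∃ c ∈ C, ∃ v, v ∉ C ∧ A v c ∧ Relation.ReflTransGen r u₀ v := by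
      rcases diam u₀ c₀ (hne _ hc₀).symm with h | ⟨z, h, h'⟩
      · exact ⟨c₀, hc₀, u₀, hu₀, h, .refl⟩
      · by_cases hz : z ∈ C
        · exact ⟨z, hz, u₀, hu₀, h, .refl⟩
        · exact ⟨c₀, hc₀, z, hz, h', .single ⟨h, hu₀, hz⟩⟩
    have key : ∀ c ∈ C, ∀ c' ∈ C, ∀ u v, u ∉ C → v ∉ C → A c u →
        Relation.ReflTransGen r u v → A v c' → c = c' := by
      intro c hc c' hc' u v h1 h2 h3 h4 h5
      by_contra h
      exact hbyp ⟨c, hc, c', hc', h, u, v, h1, h2, h3, h4, h5⟩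
    have huv' := huu.trans huv
    obtain rfl := key c hc c' hc' u v hu hv hcu huv' hvc
    have noOut : ∀ x ∈ C, x ≠ c → ∀ w, w ∉ C → Relation.ReflTransGen r u w → ¬ A w x :=
      fun x hx hxc w hw h h' => hxc (key c hc x hx u w hu hw hcu h h').symm
    have noIn : ∀ x ∈ C, x ≠ c → ∀ w, w ∉ C → Relation.ReflTransGen r w u → ¬ A x w :=
      fun x hx hxc w hw h h' => hxc (key x hx c hc w v hw hv h' (h.trans huv') hvc)
    obtain ⟨x, hx, hxc⟩ : ∃ x ∈ C, x ≠ c := by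
      apply Finset.exists_mem_ne
      have := List.length_pos_iff.2 hne0
      omega
    have hux : u ≠ x := by rintro rfl; exact hu hx
    have hAux : ¬ A u x := noOut x hx hxc u hu .refl
    have hAxu : ¬ A x u := noIn x hx hxc u hu .refl
    have H := nonadj u x hux hAux hAxu
    have H1 := outside u x hu hAux hAxu
      (fun w hw h => noOut x hx hxc w hw (.single ⟨h.1, hu, hw⟩) h.2)
      (fun w hw h => noIn x hx hxc w hw (.single ⟨h.2, hw, hu⟩) h.1)
    have H2 : ∑ w ∈ C, g A u w ≤ 2 := by
      rw [Finset.sum_eq_single_of_mem c hc]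
      · exact g_le A u c
      · intro w hw hwc
        simp [g, noOut w hw hwc u hu .refl, noIn w hw hwc u hu .refl]
    have H4 : ∑ w ∈ C, g A x w + 2 ≤ 2 * C.card := by
      rw [← Finset.add_sum_erase _ _ hx]
      have e0 : g A x x = 0 := by simp [g, hirr]
      have := Finset.sum_le_card_nsmul (C.erase x) (fun w => g A x w) 2 (fun w _ => g_le A x w)
      rw [Finset.card_erase_of_mem hx] at this
      have := Finset.card_pos.2 ⟨x, hx⟩
      simp only [smul_eq_mul] at *
      omega
    have H7 := Finset.sum_compl_add_sum C (fun w => g A u w + g A x w)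
    rw [Finset.sum_add_distrib (s := C)] at H7
    omega
end
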